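/- Let (X,d) be a compact connected metric space, Λ a finite nonempty set, and ℱ = {X; f_λ | λ ∈ Λ} an IFS of continuous maps which has the shadowing property. Then the following are equivalent: (1) ℱ is topologically mixing; (2) ℱ is totally chain transitive; (3) ℱ is chain transitive; (4) ℱ is chain recurrent. -/

import Mathlib

/-- An `ε`-chain of length `n` from `x` to `y` for the IFS `{X; f l | l : Λ}`:
points `c 0 = x, …, c n = y` together with indices `lam i` such that
`dist (f (lam i) (c i)) (c (i+1)) < ε` for all `i < n`. -/
def IFSChain {X Λ : Type*} [MetricSpace X] (f : Λ → X → X) (ε : ℝ) (n : ℕ)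
    (x y : X) : Prop :=
  ∃ (c : ℕ → X) (lam : ℕ → Λ), c 0 = x ∧ c n = y ∧
    ∀ i < n, dist (f (lam i) (c i)) (c (i + 1)) < ε

/-- The IFS is chain transitive: any point can be joined to any other point by an
`ε`-chain, for every `ε > 0`. -/
def IFSChainTransitive {X Λ : Type*} [MetricSpace X] (f : Λ → X → X) : Prop :=
  ∀ x y : X, ∀ ε : ℝ, 0 < ε → ∃ n : ℕ, 1 ≤ n ∧ IFSChain f ε n x y

/-- The IFS is chain mixing: for every `ε > 0` there is `N > 0` such that any two
points are joined by an `ε`-chain of length exactly `n`, for every `n > N`. -/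
def IFSChainMixing {X Λ : Type*} [MetricSpace X] (f : Λ → X → X) : Prop :=
  ∀ ε : ℝ, 0 < ε → ∃ N : ℕ, 0 < N ∧ ∀ x y : X, ∀ n : ℕ, N < n → IFSChain f ε n x y

/-- The IFS is chain recurrent: every point admits an `ε`-chain (of length `≥ 1`)
back to itself, for every `ε > 0`. -/
def IFSChainRecurrent {X Λ : Type*} [MetricSpace X] (f : Λ → X → X) : Prop :=
  ∀ x : X, ∀ ε : ℝ, 0 < ε → ∃ n : ℕ, 1 ≤ n ∧ IFSChain f ε n x x

/-- The maps of the IFS `ℱⁿ`: the composition `f (lam (n-1)) ∘ ⋯ ∘ f (lam 0)`. -/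
def iterMap {X Λ : Type*} (f : Λ → X → X) (n : ℕ) (lam : Fin n → Λ) : X → X :=
  fun x => (List.ofFn lam).foldl (fun y l => f l y) x

/-- The IFS is totally chain transitive: `ℱⁿ` is chain transitive for all `n ≥ 1`. -/
def IFSTotallyChainTransitive {X Λ : Type*} [MetricSpace X] (f : Λ → X → X) : Prop :=
  ∀ n : ℕ, 1 ≤ n → IFSChainTransitive (iterMap f n)

/-- For `σ = (λ_1, λ_2, …) ∈ Λ^ℕ`, `orbitIter f σ n = ℱ_{σ_n} = f_{λ_n} ∘ ⋯ ∘ f_{λ_1}`. -/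
def orbitIter {X Λ : Type*} (f : Λ → X → X) (σ : ℕ → Λ) : ℕ → X → X
  | 0 => id
  | n + 1 => fun x => f (σ n) (orbitIter f σ n x)

/-- The IFS is topologically mixing: for every pair of nonempty open sets `U, V`
there is `N` such that for every `n > N` some `ℱ_{σ_n}` maps `U` to meet `V`. -/
def IFSTopologicallyMixing {X Λ : Type*} [MetricSpace X] (f : Λ → X → X) : Prop :=
  ∀ U V : Set X, IsOpen U → IsOpen V → U.Nonempty → V.Nonempty →
    ∃ N : ℕ, ∀ n : ℕ, N < n → ∃ σ : ℕ → Λ, (orbitIter f σ n '' U ∩ V).Nonempty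

/-- The IFS has the shadowing property: every `δ`-pseudo-orbit is `ε`-shadowed by a
genuine orbit of the IFS. -/
def IFSShadowing {X Λ : Type*} [MetricSpace X] (f : Λ → X → X) : Prop :=
  ∀ ε : ℝ, 0 < ε → ∃ δ : ℝ, 0 < δ ∧ ∀ (c : ℕ → X) (lam : ℕ → Λ),
    (∀ i : ℕ, dist (f (lam i) (c i)) (c (i + 1)) < δ) →
    ∃ (σ : ℕ → Λ) (y : X), dist (c 0) y ≤ ε ∧
      ∀ n : ℕ, 1 ≤ n → dist (c n) (orbitIter f σ n y) ≤ ε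

section Iterates

variable {X Λ : Type*}

theorem iterMap_succ (f : Λ → X → X) (n : ℕ) (lam : Fin (n + 1) → Λ) (x : X) :
    iterMap f (n + 1) lam x = f (lam (Fin.last n)) (iterMap f n (fun i => lam i.castSucc) x) := by
  simp [iterMap, List.ofFn_succ_last, -List.ofFn_succ]

theorem orbitIter_add (f : Λ → X → X) (σ : ℕ → Λ) (m n : ℕ) (x : X) :
    orbitIter f σ (m + n) x = iterMap f n (fun i => σ (m + i)) (orbitIter f σ m x) := by
  induction n with
  | zero => simp [iterMap]
  | succ n ih =>
    simp [iterMap_succ, orbitIter, ih]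

end Iterates

section ChainConditions

open Filter Topology

namespace IFSChain

variable {X Λ : Type*} [MetricSpace X] {f : Λ → X → X} {ε : ℝ} {m n : ℕ} {x y z : X}

theorem refl [Nonempty Λ] (f : Λ → X → X) (ε : ℝ) (x : X) : IFSChain f ε 0 x x :=
  ⟨fun _ => x, fun _ => Classical.arbitrary Λ, rfl, rfl, by simp⟩

theorem cons {l : Λ} (h : dist (f l x) y < ε) (hc : IFSChain f ε n y z) :
    IFSChain f ε (n + 1) x z := by
  obtain ⟨c, lam, h0, hn, hstep⟩ := hc
  refine ⟨fun i => Nat.casesOn i x c, fun i => Nat.casesOn i l lam, rfl, hn, ?_⟩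
  rintro (_ | i) hi
  · simpa [h0] using h
  · exact hstep i (by omega)

theorem exists_of_succ (hc : IFSChain f ε (n + 1) x z) :
    ∃ l y, dist (f l x) y < ε ∧ IFSChain f ε n y z := by
  obtain ⟨c, lam, h0, hn, hstep⟩ := hc
  exact ⟨lam 0, c 1, h0 ▸ hstep 0 (by omega), fun i => c (i + 1), fun i => lam (i + 1), rfl, hn,
    fun i hi => hstep (i + 1) (by omega)⟩

theorem exists_of_succ' (hc : IFSChain f ε (n + 1) x z) :
    ∃ l y, IFSChain f ε n x y ∧ dist (f l y) z < ε := by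
  obtain ⟨c, lam, h0, hn, hstep⟩ := hc
  exact ⟨lam n, c n, ⟨c, lam, h0, rfl, fun i hi => hstep i (by omega)⟩,
    hn ▸ hstep n (by omega)⟩

theorem trans (h₁ : IFSChain f ε m x y) (h₂ : IFSChain f ε n y z) :
    IFSChain f ε (m + n) x z := by
  induction m generalizing x with
  | zero =>
    obtain ⟨c, lam, h0, hn, -⟩ := h₁
    rw [zero_add]
    rwa [show x = y from h0.symm.trans hn]
  | succ m ih =>
    obtain ⟨l, w, hw, h⟩ := h₁.exists_of_succ
    rw [Nat.add_right_comm]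
    exact (ih h).cons hw

theorem single [Nonempty Λ] {l : Λ} (h : dist (f l x) y < ε) : IFSChain f ε 1 x y :=
  (refl f ε y).cons h

/-- The end point of a chain of positive length can be moved slightly. -/
theorem eventually_right [Nonempty Λ] (hn : 1 ≤ n) (h : IFSChain f ε n x y) :
    ∀ᶠ z in 𝓝 y, IFSChain f ε n x z := by
  obtain ⟨n, rfl⟩ := Nat.exists_eq_add_of_le' hn
  obtain ⟨l, w, hw, hlw⟩ := h.exists_of_succ'
  have : Tendsto (fun z => dist (f l w) z) (𝓝 y) (𝓝 (dist (f l w) y)) :=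
    (continuous_const.dist continuous_id).tendsto y
  filter_upwards [this.eventually_lt_const hlw] with z hz
  exact hw.trans (single hz)

/-- The starting point of a chain of positive length can be moved slightly. -/
theorem eventually_left (hf : ∀ l, Continuous (f l)) (hn : 1 ≤ n) (h : IFSChain f ε n x y) :
    ∀ᶠ z in 𝓝 x, IFSChain f ε n z y := by
  obtain ⟨n, rfl⟩ := Nat.exists_eq_add_of_le' hn
  obtain ⟨l, w, hlw, hw⟩ := h.exists_of_succ
  have : Tendsto (fun z => dist (f l z) w) (𝓝 x) (𝓝 (dist (f l x) w)) :=
    ((hf l).dist continuous_const).tendsto x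
  filter_upwards [this.eventually_lt_const hlw] with z hz
  exact hw.cons hz

end IFSChain

variable {X Λ : Type*} [MetricSpace X] {f : Λ → X → X}

theorem IFSChainTransitive.chainRecurrent (h : IFSChainTransitive f) : IFSChainRecurrent f :=
  fun x => h x x

/-- On a connected space, chain recurrence implies chain transitivity. -/
theorem IFSChainRecurrent.chainTransitive [PreconnectedSpace X] [Nonempty Λ]
    (hf : ∀ l, Continuous (f l)) (h : IFSChainRecurrent f) : IFSChainTransitive f := by
  intro x y ε hε
  let R : Set X := {z | ∃ n : ℕ, 1 ≤ n ∧ IFSChain f ε n x z}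
  have hopen : IsOpen R := by
    refine isOpen_iff_mem_nhds.2 fun z hz => ?_
    obtain ⟨n, hn, hc⟩ := hz
    filter_upwards [hc.eventually_right hn] with w hw
    exact ⟨n, hn, hw⟩
  have hclosed : IsClosed R := by
    refine isClosed_of_closure_subset fun z hz => ?_
    obtain ⟨m, hm, hc⟩ := h z ε hε
    obtain ⟨w, hwz, n, hn, hxw⟩ :=
      mem_closure_iff_nhds.1 hz _ (hc.eventually_left hf hm)
    exact ⟨n + m, by omega, hxw.trans hwz⟩
  have huniv : R = Set.univ := IsClopen.eq_univ ⟨hclosed, hopen⟩ ⟨x, h x ε hε⟩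
  exact huniv.ge (Set.mem_univ y)

/-- On a connected space, the lengths of the `ε`-chains from a point to itself have no common
divisor. -/
theorem IFSChainTransitive.eq_one_of_dvd_lengths [PreconnectedSpace X] [Nonempty Λ]
    (h : IFSChainTransitive f) {ε : ℝ} (hε : 0 < ε) (x : X) {g : ℕ}
    (hg : ∀ n, IFSChain f ε n x x → g ∣ n) : g = 1 := by
  choose len hlen hchain using fun y => h x y ε hε
  have hlen_eq {n : ℕ} {y : X} (hc : IFSChain f ε n x y) : (n : ZMod g) = len y := by
    obtain ⟨m, -, hm⟩ := h y x ε hε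
    have h₁ := (ZMod.natCast_eq_zero_iff _ _).2 (hg _ (hc.trans hm))
    have h₂ := (ZMod.natCast_eq_zero_iff _ _).2 (hg _ ((hchain y).trans hm))
    push_cast at h₁ h₂
    exact add_right_cancel (h₁.trans h₂.symm)
  have hconst : IsLocallyConstant fun y => (len y : ZMod g) := by
    refine (IsLocallyConstant.iff_eventually_eq _).2 fun y => ?_
    filter_upwards [(hchain y).eventually_right (hlen y)] with z hz
    exact (hlen_eq hz).symm
  obtain ⟨l⟩ := ‹Nonempty Λ›
  have hstep := hlen_eq ((hchain x).trans
    (IFSChain.single (l := l) (by simpa using hε : dist (f l x) (f l x) < ε)))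
  rw [hconst.apply_eq_of_preconnectedSpace (f l x) x, Nat.cast_add, Nat.cast_one,
    add_eq_left] at hstep
  exact Nat.dvd_one.1 ((ZMod.natCast_eq_zero_iff 1 g).1 (by simpa using hstep))

/-- On a connected space, chain transitivity gives chains of every large enough length between
any two points. -/
theorem IFSChainTransitive.eventually_chain [PreconnectedSpace X] [Nonempty Λ]
    (h : IFSChainTransitive f) {ε : ℝ} (hε : 0 < ε) (x y : X) :
    ∀ᶠ n in atTop, IFSChain f ε n x y := by
  let S : AddSubmonoid ℕ :=
    { carrier := {n | IFSChain f ε n x x}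
      zero_mem' := IFSChain.refl f ε x
      add_mem' := fun ha hb => ha.trans hb }
  have hgcd : Nat.setGcd (S : Set ℕ) = 1 :=
    h.eq_one_of_dvd_lengths hε x fun n hn => Nat.setGcd_dvd_of_mem (s := (S : Set ℕ)) hn
  obtain ⟨N, hN⟩ := Nat.exists_mem_closure_of_ge (S : Set ℕ)
  obtain ⟨m, -, hm⟩ := h x y ε hε
  filter_upwards [eventually_ge_atTop (N + m)] with n hn
  have hmem := hN (n - m) (by omega) (hgcd ▸ one_dvd _)
  rw [AddSubmonoid.closure_eq] at hmem
  have hchain : IFSChain f ε (n - m) x x := hmem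
  simpa [show n - m + m = n by omega] using hchain.trans hm

/-- A shadowing IFS follows every finite chain of positive length, up to its end points. -/
theorem IFSShadowing.exists_orbit [Nonempty Λ] (h : IFSShadowing f) {ε : ℝ} (hε : 0 < ε) :
    ∃ δ > 0, ∀ (n : ℕ) (x y : X), 1 ≤ n → IFSChain f δ n x y →
      ∃ (σ : ℕ → Λ) (z : X), dist x z ≤ ε ∧ dist y (orbitIter f σ n z) ≤ ε := by
  obtain ⟨δ, hδ, hsh⟩ := h ε hε
  refine ⟨δ, hδ, fun n x y hn ⟨c, lam, h0, hcn, hstep⟩ => ?_⟩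
  let τ : ℕ → Λ := fun _ => Classical.arbitrary Λ
  obtain ⟨σ, z, hz0, hz⟩ := hsh
    (fun i => if i ≤ n then c i else orbitIter f τ (i - n) y)
    (fun i => if i < n then lam i else Classical.arbitrary Λ) (by
      intro i
      rcases lt_trichotomy i n with hi | rfl | hi
      · simpa [hi, hi.le, Nat.succ_le_of_lt hi] using hstep i hi
      · simpa [hcn, orbitIter, τ] using hδ
      · simp [hi.not_ge, hi.not_gt, show ¬ i + 1 ≤ n by omega,
          show i + 1 - n = (i - n) + 1 by omega, orbitIter, τ, hδ])
  exact ⟨σ, z, by simpa [h0] using hz0, by simpa [hcn] using hz n hn⟩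

/-- On a connected space, a chain transitive IFS with the shadowing property is topologically
mixing. -/
theorem IFSChainTransitive.topologicallyMixing [PreconnectedSpace X] [Nonempty Λ]
    (h : IFSChainTransitive f) (hsh : IFSShadowing f) : IFSTopologicallyMixing f := by
  rintro U V hU hV ⟨u, hu⟩ ⟨v, hv⟩
  obtain ⟨ε₁, hε₁, hεU⟩ := Metric.nhds_basis_closedBall.mem_iff.1 (hU.mem_nhds hu)
  obtain ⟨ε₂, hε₂, hεV⟩ := Metric.nhds_basis_closedBall.mem_iff.1 (hV.mem_nhds hv)
  obtain ⟨δ, hδ, horbit⟩ := hsh.exists_orbit (lt_min hε₁ hε₂)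
  obtain ⟨N, hN⟩ := eventually_atTop.1 (h.eventually_chain hδ u v)
  refine ⟨N, fun n hn => ?_⟩
  obtain ⟨σ, z, hz, hz'⟩ := horbit n u v (by omega) (hN n hn.le)
  refine ⟨σ, _, ⟨z, hεU ?_, rfl⟩, hεV ?_⟩
  · exact Metric.mem_closedBall'.2 (hz.trans (min_le_left _ _))
  · exact Metric.mem_closedBall'.2 (hz'.trans (min_le_right _ _))

theorem continuous_iterMap (hf : ∀ l, Continuous (f l)) (n : ℕ) (lam : Fin n → Λ) :
    Continuous (iterMap f n lam) := by
  induction n with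
  | zero => exact continuous_id.congr fun x => by simp [iterMap]
  | succ n ih =>
    rw [funext (iterMap_succ f n lam)]
    exact (hf _).comp (ih _)

/-- An orbit, observed at multiples of `n`, is a chain of the `n`-th iterate of the IFS. -/
theorem IFSChain.iterMap_orbitIter [Nonempty Λ] (f : Λ → X → X) {ε : ℝ} (hε : 0 < ε) (σ : ℕ → Λ)
    (m n k : ℕ) (x : X) :
    IFSChain (iterMap f n) ε k (orbitIter f σ m x) (orbitIter f σ (m + n * k) x) := by
  refine ⟨fun i => orbitIter f σ (m + n * i) x, fun i j => σ (m + n * i + j), rfl, rfl, ?_⟩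
  intro i _
  dsimp only
  rw [mul_add, mul_one, ← add_assoc, orbitIter_add f σ _ n x, dist_self]
  exact hε

/-- A topologically mixing IFS of continuous maps is totally chain transitive. -/
theorem IFSTopologicallyMixing.totallyChainTransitive [Finite Λ] [Nonempty Λ]
    (hf : ∀ l, Continuous (f l)) (h : IFSTopologicallyMixing f) :
    IFSTotallyChainTransitive f := by
  intro n hn x y ε hε
  let U : Set X := ⋂ lam : Fin n → Λ, {z | dist (iterMap f n lam x) (iterMap f n lam z) < ε}
  have hU : IsOpen U := isOpen_iInter_of_finite fun lam =>
    isOpen_lt (continuous_const.dist (continuous_iterMap hf n lam)) continuous_const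
  obtain ⟨N, hN⟩ := h U (Metric.ball y ε) hU Metric.isOpen_ball
    ⟨x, by simp [U, hε]⟩ ⟨y, Metric.mem_ball_self hε⟩
  obtain ⟨σ, -, ⟨z, hzU, rfl⟩, hzV⟩ := hN (n + n * N + n) (by nlinarith)
  rw [orbitIter_add, Metric.mem_ball] at hzV
  have hstart : dist (iterMap f n (fun i => σ (0 + i)) x)
      (iterMap f n (fun i => σ (0 + i)) z) < ε := Set.mem_iInter.1 hzU _
  have hfirst : orbitIter f σ n z = iterMap f n (fun i => σ (0 + i)) z := by
    simpa [orbitIter] using orbitIter_add f σ 0 n z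
  rw [← hfirst] at hstart
  exact ⟨_, by omega, ((IFSChain.iterMap_orbitIter f hε σ n n N z).cons hstart).trans
    (IFSChain.single hzV)⟩

theorem IFSTotallyChainTransitive.chainTransitive [Nonempty Λ]
    (h : IFSTotallyChainTransitive f) : IFSChainTransitive f := by
  intro x y ε hε
  obtain ⟨n, hn, c, lam, h0, hcn, hstep⟩ := h 1 le_rfl x y ε hε
  exact ⟨n, hn, c, fun i => lam i 0, h0, hcn, fun i hi => by simpa [iterMap] using hstep i hi⟩

end ChainConditions

/-- For an IFS of continuous maps with the shadowing property on a
compact connected metric space, the following are equivalent: (1) topologically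
mixing; (2) totally chain transitive; (3) chain transitive; (4) chain recurrent. -/
theorem ifs_shadowing_chain_conditions_tfae
    {X Λ : Type*} [MetricSpace X] [CompactSpace X] [ConnectedSpace X]
    [Finite Λ] [Nonempty Λ]
    (f : Λ → X → X) (hf : ∀ l : Λ, Continuous (f l)) (hsh : IFSShadowing f) :
    List.TFAE [IFSTopologicallyMixing f, IFSTotallyChainTransitive f,
      IFSChainTransitive f, IFSChainRecurrent f] := by
  tfae_have 1 → 2 := fun h => h.totallyChainTransitive hf
  tfae_have 2 → 3 := fun h => h.chainTransitive
  tfae_have 3 → 4 := fun h => h.chainRecurrent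
  tfae_have 4 → 1 := fun h => (h.chainTransitive hf).topologicallyMixing hsh
  tfae_finish
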